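/- For every fixed t ∈ [0,T], the value function m ↦ V(t,m) is convex on 𝒫₂: for all m₁, m₂ ∈ 𝒫₂ and λ ∈ (0,1), V(t, λm₁ + (1−λ)m₂) ≤ λ V(t,m₁) + (1−λ) V(t,m₂). -/

import Mathlib

open MeasureTheory Filter Set
open scoped Topology ENNReal NNReal BoundedContinuousFunction

noncomputable section

/-- Euclidean space `ℝ^d`. -/
abbrev Ed (d : ℕ) : Type := EuclideanSpace ℝ (Fin d)

/-- `m ∈ 𝒫_p` : Borel probability measure on `ℝ^d` with finite `p`-th moment. -/
def MemP (d : ℕ) (p : ℝ) (m : Measure (Ed d)) : Prop :=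
  IsProbabilityMeasure m ∧ Integrable (fun x => ‖x‖ ^ p) m

/-- `γ` is a coupling of `m` and `m'`. -/
def IsCoupling (d : ℕ) (γ : Measure (Ed d × Ed d)) (m m' : Measure (Ed d)) : Prop :=
  γ.map Prod.fst = m ∧ γ.map Prod.snd = m'

/-- The `p`-Wasserstein distance. -/
def wdist (d : ℕ) (p : ℝ) (m m' : Measure (Ed d)) : ℝ :=
  sInf { c : ℝ | ∃ γ : Measure (Ed d × Ed d), IsProbabilityMeasure γ ∧ IsCoupling d γ m m' ∧
      c = (∫ q, ‖q.1 - q.2‖ ^ p ∂γ) ^ (1 / p) }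

/-- The Gaussian kernel `ρ_δ`. -/
def gaussDensity (d : ℕ) (δ : ℝ) (x : Ed d) : ℝ :=
  (2 * Real.pi * δ) ^ (-(d : ℝ) / 2) * Real.exp (-‖x‖ ^ 2 / (2 * δ))

/-- The centered Gaussian measure with variance `δ` on `ℝ^d`. -/
def gaussMeasure (d : ℕ) (δ : ℝ) : Measure (Ed d) :=
  volume.withDensity fun x => ENNReal.ofReal (gaussDensity d δ x)

/-- The heat flow `p^{t,m}_s` : the law at time `s` of a Brownian motion started
at time `t` with initial law `m`. -/
def heatFlow (d : ℕ) (t s : ℝ) (m : Measure (Ed d)) : Measure (Ed d) :=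
  if s ≤ t then m
  else Measure.map (fun q : Ed d × Ed d => q.1 + q.2) (m.prod (gaussMeasure d (s - t)))

/-- The natural filtration of a measure-valued process, made right-continuous:
`𝓕^M_s = ⋂_{u > s} σ(M_r, r ∈ [t,u])`. -/
def genFiltration {Ω : Type} (d : ℕ) (M : ℝ → Ω → Measure (Ed d)) (t s : ℝ) :
    MeasurableSpace Ω :=
  ⨅ u ∈ Set.Ioi s, ⨆ r ∈ Set.Icc t u, MeasurableSpace.comap (M r) inferInstance

/-- A path `[t,T] → (𝒫₁,d₁)` is càdlàg: right-continuous with left limits (for `d₁`). -/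
def CadlagD1 (d : ℕ) (t T : ℝ) (g : ℝ → Measure (Ed d)) : Prop :=
  (∀ s ∈ Set.Ico t T, Tendsto (fun r => wdist d 1 (g r) (g s)) (𝓝[Set.Ici s] s) (𝓝 0)) ∧
  (∀ s ∈ Set.Ioc t T, ∃ μ : Measure (Ed d),
      Tendsto (fun r => wdist d 1 (g r) μ) (𝓝[Set.Ico t s] s) (𝓝 0))

/-- An element of `𝓜(t,m)` : a càdlàg `(𝒫₁,d₁)`-valued process `M = (M_s)_{s∈[t,T]}`
on some probability space such that (i) `E[M_t(φ)] = m(φ)` for all bounded continuous `φ`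
and (ii) `E[M_{t₂}(φ) | 𝓕^M_{t₁}] = p^{t₁,M_{t₁}}_{t₂}(φ)` for all `t ≤ t₁ ≤ t₂ ≤ T` and
all bounded continuous `φ`. -/
structure MVP (d : ℕ) (T t : ℝ) (m : Measure (Ed d)) where
  Ω : Type
  mΩ : MeasurableSpace Ω
  P : @Measure Ω mΩ
  probP : IsProbabilityMeasure P
  M : ℝ → Ω → Measure (Ed d)
  meas : ∀ s, @Measurable Ω (Measure (Ed d)) mΩ inferInstance (M s)
  inP1 : ∀ s ∈ Set.Icc t T, ∀ ω, MemP d 1 (M s ω)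
  cadlag : ∀ ω, CadlagD1 d t T (fun s => M s ω)
  init : ∀ φ : Ed d →ᵇ ℝ, ∫ ω, (∫ x, φ x ∂(M t ω)) ∂P = ∫ x, φ x ∂m
  cond : ∀ t₁ t₂ : ℝ, t ≤ t₁ → t₁ ≤ t₂ → t₂ ≤ T → ∀ φ : Ed d →ᵇ ℝ,
    P[(fun ω => ∫ x, φ x ∂(M t₂ ω)) | genFiltration d M t t₁]
      =ᵐ[P] fun ω => ∫ x, φ x ∂(heatFlow d t₁ t₂ (M t₁ ω))
/-- The Hamiltonian `H(t,m) = inf_u sup_v ∫ f(t,x,u,v) dm(x)`. -/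
def hamiltonian {d : ℕ} {A B : Type} (f : ℝ → Ed d → A → B → ℝ)
    (t : ℝ) (m : Measure (Ed d)) : ℝ :=
  ⨅ u : A, ⨆ v : B, ∫ x, f t x u v ∂m

/-- The cost `E[∫_t^T H(s, M_s) ds]` of a measure-valued process. -/
def mvCost {d : ℕ} {A B : Type} (f : ℝ → Ed d → A → B → ℝ)
    {T t : ℝ} {m : Measure (Ed d)} (X : MVP d T t m) : ℝ :=
  ∫ ω, (∫ s in Set.Icc t T, hamiltonian f s (X.M s ω)) ∂X.P

/-- The value function `V(t,m) = inf_{M ∈ 𝓜(t,m)} E[∫_t^T H(s, M_s) ds]`. -/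
def gameValue (d : ℕ) {A B : Type} (f : ℝ → Ed d → A → B → ℝ)
    (T t : ℝ) (m : Measure (Ed d)) : ℝ :=
  sInf { r : ℝ | ∃ X : MVP d T t m, r = mvCost f X }

/-- The law of `a • Z` with `Z` a standard Gaussian vector. -/
def scaledGaussian (d : ℕ) (a : ℝ) : Measure (Ed d) :=
  (ProbabilityTheory.stdGaussian (Ed d)).map (fun x => a • x)

instance isProbabilityMeasure_scaledGaussian (d : ℕ) (a : ℝ) :
    IsProbabilityMeasure (scaledGaussian d a) :=
  Measure.isProbabilityMeasure_map (by fun_prop)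

lemma charFun_scaledGaussian (d : ℕ) (a : ℝ) (w : Ed d) :
    charFun (scaledGaussian d a) w = Complex.exp (-(a ^ 2 * ‖w‖ ^ 2) / 2) := by
  rw [scaledGaussian, charFun_map_smul, ProbabilityTheory.charFun_stdGaussian, norm_smul,
    Real.norm_eq_abs, Complex.ofReal_mul, mul_pow, ← Complex.ofReal_pow |a|, sq_abs,
    Complex.ofReal_pow]

lemma scaledGaussian_conv (d : ℕ) {a b c : ℝ} (h : c ^ 2 = a ^ 2 + b ^ 2) :
    (scaledGaussian d a).conv (scaledGaussian d b) = scaledGaussian d c := by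
  apply Measure.ext_of_charFun
  ext w
  have h' : (c : ℂ) ^ 2 = (a : ℂ) ^ 2 + (b : ℂ) ^ 2 := by exact_mod_cast h
  rw [charFun_conv]
  simp only [charFun_scaledGaussian, h', ← Complex.exp_add]
  congr 1
  ring

lemma scaledGaussian_zero (d : ℕ) : scaledGaussian d 0 = Measure.dirac 0 := by
  simp [scaledGaussian, Measure.map_const]

lemma integrable_gaussDensity (d : ℕ) {δ : ℝ} (hδ : 0 < δ) :
    Integrable (gaussDensity d δ) := by
  have h := GaussianFourier.integrable_cexp_neg_mul_sq_norm_add (V := Ed d) (b := (1 / (2 * δ) : ℝ))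
    (by rw [Complex.ofReal_re]; positivity) 0 0
  have h2 := (h.norm).const_mul ((2 * Real.pi * δ) ^ (-(d : ℝ) / 2))
  refine h2.congr (.of_forall fun x => ?_)
  simp only [gaussDensity, Complex.norm_exp]
  congr 2
  simp [← Complex.ofReal_pow, ← Complex.ofReal_mul]
  norm_cast
  field_simp

lemma gaussDensity_nonneg (d : ℕ) {δ : ℝ} (hδ : 0 < δ) (x : Ed d) : 0 ≤ gaussDensity d δ x := by
  unfold gaussDensity; positivity

lemma charFun_gaussMeasure (d : ℕ) {δ : ℝ} (hδ : 0 < δ) (w : Ed d) :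
    charFun (gaussMeasure d δ) w = Complex.exp (-(δ * ‖w‖ ^ 2) / 2) := by
  rw [charFun_apply, gaussMeasure, integral_withDensity_eq_integral_toReal_smul₀
    (integrable_gaussDensity d hδ).aemeasurable.ennreal_ofReal (.of_forall fun x => by simp)]
  have h := GaussianFourier.integral_cexp_neg_mul_sq_norm_add (V := Ed d) (b := (1 / (2 * δ) : ℝ))
    (by rw [Complex.ofReal_re]; positivity) Complex.I w
  have hδ' : (δ : ℂ) ≠ 0 := by exact_mod_cast hδ.ne'
  calc _ = ∫ x : Ed d, (((2 * Real.pi * δ) ^ (-(d : ℝ) / 2) : ℝ) : ℂ) *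
        Complex.exp (-((1 / (2 * δ) : ℝ) : ℂ) * ‖x‖ ^ 2 + Complex.I * inner ℝ w x) := by
        congr 1 with x
        rw [ENNReal.toReal_ofReal (gaussDensity_nonneg d hδ x), gaussDensity, Complex.real_smul,
          Complex.ofReal_mul, mul_assoc, Complex.ofReal_exp, ← Complex.exp_add, real_inner_comm]
        congr 2
        push_cast
        field_simp
    _ = _ := by
        rw [integral_const_mul, h, ← mul_assoc]
        have h1 : (Real.pi / ((1 / (2 * δ) : ℝ) : ℂ)) ^ (Module.finrank ℝ (Ed d) / 2 : ℂ)
            = (((2 * Real.pi * δ) ^ ((d : ℝ) / 2) : ℝ) : ℂ) := by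
          rw [Complex.ofReal_cpow (by positivity)]
          congr 1
          · push_cast; field_simp
          · simp
        rw [h1, ← Complex.ofReal_mul, ← Real.rpow_add (by positivity)]
        simp only [neg_div, neg_add_cancel, Real.rpow_zero, Complex.ofReal_one, one_mul]
        congr 1
        push_cast
        rw [Complex.I_sq]
        field_simp
        norm_num

lemma gaussMeasure_eq_scaledGaussian (d : ℕ) {δ : ℝ} (hδ : 0 < δ) :
    gaussMeasure d δ = scaledGaussian d (√δ) := by
  have : IsFiniteMeasure (gaussMeasure d δ) :=
    isFiniteMeasure_withDensity_ofReal (integrable_gaussDensity d hδ).2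
  apply Measure.ext_of_charFun
  ext w
  have h : (√δ : ℂ) ^ 2 = δ := by exact_mod_cast Real.sq_sqrt hδ.le
  rw [charFun_gaussMeasure d hδ, charFun_scaledGaussian, h]

lemma heatFlow_eq_conv (d : ℕ) (t s : ℝ) (m : Measure (Ed d)) [SFinite m] :
    heatFlow d t s m = m.conv (scaledGaussian d (√(s - t))) := by
  unfold heatFlow
  split_ifs with h
  · rw [Real.sqrt_eq_zero_of_nonpos (by linarith), scaledGaussian_zero, Measure.conv_dirac_zero]
  · rw [gaussMeasure_eq_scaledGaussian d (by linarith)]; rfl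

lemma heatFlow_heatFlow (d : ℕ) {t r s : ℝ} (htr : t ≤ r) (hrs : r ≤ s) (m : Measure (Ed d))
    [SFinite m] : heatFlow d r s (heatFlow d t r m) = heatFlow d t s m := by
  rw [heatFlow_eq_conv d t r, heatFlow_eq_conv, heatFlow_eq_conv, Measure.conv_assoc,
    scaledGaussian_conv d]
  rw [Real.sq_sqrt (by linarith), Real.sq_sqrt (by linarith), Real.sq_sqrt (by linarith)]
  ring

lemma integrable_norm_stdGaussian (d : ℕ) :
    Integrable (fun z : Ed d => ‖z‖) (ProbabilityTheory.stdGaussian (Ed d)) :=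
  ProbabilityTheory.IsGaussian.integrable_id.norm

lemma conv_scaledGaussian (d : ℕ) (a : ℝ) (m : Measure (Ed d)) [SFinite m] :
    m.conv (scaledGaussian d a) = (m.prod (ProbabilityTheory.stdGaussian (Ed d))).map
      (fun q => q.1 + a • q.2) := by
  rw [Measure.conv, scaledGaussian, ← Measure.map_id (μ := m),
    Measure.map_prod_map _ _ (by fun_prop) (by fun_prop), Measure.map_map (by fun_prop) (by fun_prop),
    Measure.map_id]
  rfl

lemma MemP.heatFlow {d : ℕ} {m : Measure (Ed d)} (hm : MemP d 1 m) (t s : ℝ) :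
    MemP d 1 (heatFlow d t s m) := by
  obtain ⟨hp, hi⟩ := hm
  simp only [Real.rpow_one] at hi
  rw [heatFlow_eq_conv]
  refine ⟨inferInstance, ?_⟩
  simp only [Real.rpow_one]
  rw [conv_scaledGaussian, integrable_map_measure (by fun_prop) (by fun_prop)]
  refine Integrable.mono' ((hi.comp_fst _).add
    (((integrable_norm_stdGaussian d).comp_snd m).const_mul |√(s - t)|)) (by fun_prop)
    (.of_forall fun q => ?_)
  simp only [Function.comp, norm_norm, Pi.add_apply]
  exact (norm_add_le _ _).trans (by rw [norm_smul, Real.norm_eq_abs])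

lemma wdist_nonneg (d : ℕ) (p : ℝ) (m m' : Measure (Ed d)) : 0 ≤ wdist d p m m' := by
  apply Real.sInf_nonneg
  rintro c ⟨γ, -, -, rfl⟩
  positivity

lemma wdist_le_of_coupling {d : ℕ} {m m' : Measure (Ed d)} (γ : Measure (Ed d × Ed d))
    [IsProbabilityMeasure γ] (h : IsCoupling d γ m m') :
    wdist d 1 m m' ≤ ∫ q, ‖q.1 - q.2‖ ∂γ := by
  apply csInf_le
  · refine ⟨0, ?_⟩
    rintro c ⟨γ, -, -, rfl⟩
    positivity
  · exact ⟨γ, inferInstance, h, by simp⟩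

lemma wdist_heatFlow_le {d : ℕ} (m : Measure (Ed d)) [IsProbabilityMeasure m] (t r s : ℝ) :
    wdist d 1 (heatFlow d t r m) (heatFlow d t s m) ≤
      |√(r - t) - √(s - t)| * ∫ z, ‖z‖ ∂(ProbabilityTheory.stdGaussian (Ed d)) := by
  set G := ProbabilityTheory.stdGaussian (Ed d)
  set F : Ed d × Ed d → Ed d × Ed d := fun q => (q.1 + √(r - t) • q.2, q.1 + √(s - t) • q.2)
  have hF : Measurable F := by fun_prop
  have := Measure.isProbabilityMeasure_map (μ := m.prod G) hF.aemeasurable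
  refine (wdist_le_of_coupling ((m.prod G).map F) ⟨?_, ?_⟩).trans (le_of_eq ?_)
  · rw [Measure.map_map (by fun_prop) hF, heatFlow_eq_conv, conv_scaledGaussian]; rfl
  · rw [Measure.map_map (by fun_prop) hF, heatFlow_eq_conv, conv_scaledGaussian]; rfl
  · rw [integral_map hF.aemeasurable (by fun_prop)]
    simp only [F, add_sub_add_left_eq_sub, ← sub_smul, norm_smul, Real.norm_eq_abs]
    rw [integral_const_mul, integral_fun_snd (fun z : Ed d => ‖z‖)]
    simp

lemma tendsto_wdist_heatFlow {d : ℕ} (m : Measure (Ed d)) [IsProbabilityMeasure m] (t s : ℝ) :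
    Tendsto (fun r => wdist d 1 (heatFlow d t r m) (heatFlow d t s m)) (𝓝 s) (𝓝 0) := by
  refine squeeze_zero (fun r => wdist_nonneg _ _ _ _) (fun r => wdist_heatFlow_le m t r s) ?_
  have : Continuous fun r : ℝ => |√(r - t) - √(s - t)| *
      ∫ z, ‖z‖ ∂(ProbabilityTheory.stdGaussian (Ed d)) := by fun_prop
  simpa using this.tendsto s

lemma MemP.one_of_two {d : ℕ} {m : Measure (Ed d)} (hm : MemP d 2 m) : MemP d 1 m := by
  obtain ⟨hp, hi⟩ := hm
  simp only [MemP, Real.rpow_one]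
  refine ⟨hp, (hi.add (integrable_const (1 : ℝ))).mono' (by fun_prop) (.of_forall fun x => ?_)⟩
  simp only [norm_norm, Pi.add_apply, Real.rpow_two]
  nlinarith [sq_nonneg (‖x‖ - 1)]

/-- The deterministic heat flow, as an element of `𝓜(t,m)`. -/
def heatFlowMVP {d : ℕ} (T t : ℝ) {m : Measure (Ed d)} (hm : MemP d 1 m) : MVP d T t m where
  Ω := PUnit
  mΩ := ⊤
  P := @Measure.dirac PUnit ⊤ PUnit.unit
  probP := @Measure.dirac.isProbabilityMeasure PUnit ⊤ _
  M s _ := heatFlow d t s m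
  meas _ := measurable_const
  inP1 s _ _ := hm.heatFlow t s
  cadlag _ := by
    have := hm.1
    exact ⟨fun s _ => (tendsto_wdist_heatFlow m t s).mono_left nhdsWithin_le_nhds,
      fun s _ => ⟨_, (tendsto_wdist_heatFlow m t s).mono_left nhdsWithin_le_nhds⟩⟩
  init φ := by simp [heatFlow]
  cond t₁ t₂ h1 h2 _ φ := by
    have := hm.1
    let _ : MeasurableSpace PUnit.{1} := ⊤
    simp only [heatFlow_heatFlow d h1 h2 m]
    rw [condExp_const le_top]

lemma abs_iSup_sub_iSup_le {ι : Type*} [Nonempty ι] {a b : ι → ℝ} {ε : ℝ}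
    (ha : BddAbove (range a)) (hb : BddAbove (range b)) (h : ∀ i, |a i - b i| ≤ ε) :
    |(⨆ i, a i) - ⨆ i, b i| ≤ ε := by
  rw [abs_sub_le_iff, sub_le_iff_le_add, sub_le_iff_le_add]
  constructor <;> refine ciSup_le fun i => ?_
  · linarith [le_ciSup hb i, (abs_le.1 (h i)).2]
  · linarith [le_ciSup ha i, (abs_le.1 (h i)).1]

lemma abs_iInf_sub_iInf_le {ι : Type*} [Nonempty ι] {a b : ι → ℝ} {ε : ℝ}
    (ha : BddBelow (range a)) (hb : BddBelow (range b)) (h : ∀ i, |a i - b i| ≤ ε) :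
    |(⨅ i, a i) - ⨅ i, b i| ≤ ε := by
  rw [abs_sub_le_iff, sub_le_comm, sub_le_comm (c := ε)]
  constructor <;> refine le_ciInf fun i => ?_
  · linarith [ciInf_le ha i, (abs_le.1 (h i)).2]
  · linarith [ciInf_le hb i, (abs_le.1 (h i)).1]

lemma abs_iSup_le {ι : Type*} [Nonempty ι] {a : ι → ℝ} {ε : ℝ} (h : ∀ i, |a i| ≤ ε) :
    |⨆ i, a i| ≤ ε := by
  simpa using abs_iSup_sub_iSup_le (a := a) (b := fun _ => 0)
    ⟨ε, by rintro _ ⟨i, rfl⟩; exact (abs_le.1 (h i)).2⟩ ⟨0, by rintro _ ⟨i, rfl⟩; rfl⟩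
    (by simpa using h)

lemma abs_iInf_le {ι : Type*} [Nonempty ι] {a : ι → ℝ} {ε : ℝ} (h : ∀ i, |a i| ≤ ε) :
    |⨅ i, a i| ≤ ε := by
  simpa using abs_iInf_sub_iInf_le (a := a) (b := fun _ => 0)
    ⟨-ε, by rintro _ ⟨i, rfl⟩; exact (abs_le.1 (h i)).1⟩ ⟨0, by rintro _ ⟨i, rfl⟩; rfl⟩
    (by simpa using h)

section Hamiltonian

variable {d : ℕ} {A B : Type} {f : ℝ → Ed d → A → B → ℝ} {C : ℝ}

lemma abs_integral_payoff_le (hfbdd : ∀ t x u v, |f t x u v| ≤ C) (m : Measure (Ed d))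
    [IsProbabilityMeasure m] (s : ℝ) (u : A) (v : B) : |∫ x, f s x u v ∂m| ≤ C := by
  simpa using norm_integral_le_of_norm_le_const (μ := m) (f := fun x => f s x u v)
    (.of_forall fun x => hfbdd s x u v)

lemma abs_hamiltonian_le [Nonempty A] [Nonempty B] (hfbdd : ∀ t x u v, |f t x u v| ≤ C)
    (m : Measure (Ed d)) [IsProbabilityMeasure m] (s : ℝ) : |hamiltonian f s m| ≤ C :=
  abs_iInf_le fun u => abs_iSup_le fun v => abs_integral_payoff_le hfbdd m s u v

lemma abs_hamiltonian_sub_le_of_forall [Nonempty A] [Nonempty B]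
    (hfbdd : ∀ t x u v, |f t x u v| ≤ C) {m m' : Measure (Ed d)} [IsProbabilityMeasure m]
    [IsProbabilityMeasure m'] {s r ε : ℝ}
    (h : ∀ u v, |∫ x, f s x u v ∂m - ∫ x, f r x u v ∂m'| ≤ ε) :
    |hamiltonian f s m - hamiltonian f r m'| ≤ ε := by
  have above (m : Measure (Ed d)) [IsProbabilityMeasure m] (s : ℝ) (u : A) :
      BddAbove (range fun v => ∫ x, f s x u v ∂m) :=
    ⟨C, by rintro _ ⟨v, rfl⟩; exact (abs_le.1 (abs_integral_payoff_le hfbdd m s u v)).2⟩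
  have below (m : Measure (Ed d)) [IsProbabilityMeasure m] (s : ℝ) :
      BddBelow (range fun u => ⨆ v, ∫ x, f s x u v ∂m) :=
    ⟨-C, by
      rintro _ ⟨u, rfl⟩
      exact (abs_le.1 (abs_iSup_le fun v => abs_integral_payoff_le hfbdd m s u v)).1⟩
  exact abs_iInf_sub_iInf_le (below m s) (below m' r)
    fun u => abs_iSup_sub_iSup_le (above m s u) (above m' r u) (h u)

section Topology

variable [MetricSpace A] [MetricSpace B]

lemma continuous_integral_payoff (hfbdd : ∀ t x u v, |f t x u v| ≤ C)
    (hfcont : Continuous fun q : ℝ × Ed d × A × B => f q.1 q.2.1 q.2.2.1 q.2.2.2)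
    (m : Measure (Ed d)) [IsProbabilityMeasure m] (s : ℝ) :
    Continuous fun q : A × B => ∫ x, f s x q.1 q.2 ∂m := by
  refine continuous_of_dominated (bound := fun _ => C) (fun q => ?_)
    (fun q => .of_forall fun x => hfbdd _ _ _ _) (integrable_const C) (.of_forall fun x => ?_)
  · exact (hfcont.comp (by fun_prop : Continuous fun x : Ed d => (s, x, q.1, q.2)))
      |>.aestronglyMeasurable
  · exact hfcont.comp (by fun_prop : Continuous fun q : A × B => (s, x, q.1, q.2))

lemma integrable_payoff (hfbdd : ∀ t x u v, |f t x u v| ≤ C)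
    (hfcont : Continuous fun q : ℝ × Ed d × A × B => f q.1 q.2.1 q.2.2.1 q.2.2.2)
    (m : Measure (Ed d)) [IsProbabilityMeasure m] (s : ℝ) (u : A) (v : B) :
    Integrable (fun x => f s x u v) m :=
  (integrable_const C).mono'
    (hfcont.comp (by fun_prop : Continuous fun x : Ed d => (s, x, u, v))).aestronglyMeasurable
    (.of_forall fun x => hfbdd _ _ _ _)

lemma abs_hamiltonian_sub_le [Nonempty A] [Nonempty B]
    (hfbdd : ∀ t x u v, |f t x u v| ≤ C)
    (hfcont : Continuous fun q : ℝ × Ed d × A × B => f q.1 q.2.1 q.2.2.1 q.2.2.2) {s r : ℝ}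
    (hflip : ∀ u v x x', |f s x u v - f r x' u v| ≤ C * (‖x - x'‖ + |s - r|))
    {m m' : Measure (Ed d)} (hm : MemP d 1 m) (hm' : MemP d 1 m') :
    |hamiltonian f s m - hamiltonian f r m'| ≤ C * (wdist d 1 m m' + |s - r|) := by
  obtain ⟨hp, hi⟩ := hm
  obtain ⟨hp', hi'⟩ := hm'
  simp only [Real.rpow_one] at hi hi'
  obtain ⟨u₀⟩ := ‹Nonempty A›
  obtain ⟨v₀⟩ := ‹Nonempty B›
  have hC : 0 ≤ C := (abs_nonneg _).trans (hfbdd 0 0 u₀ v₀)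
  have key : ∀ γ : Measure (Ed d × Ed d), IsProbabilityMeasure γ → IsCoupling d γ m m' →
      |hamiltonian f s m - hamiltonian f r m'| ≤ C * (∫ q, ‖q.1 - q.2‖ ∂γ + |s - r|) := by
    rintro γ hγ ⟨rfl, rfl⟩
    have hd : Integrable (fun q : Ed d × Ed d => ‖q.1 - q.2‖) γ := by
      rw [integrable_map_measure (by fun_prop) (by fun_prop)] at hi hi'
      exact (hi.add hi').mono' (by fun_prop)
        (.of_forall fun q => by simpa using norm_sub_le q.1 q.2)
    refine abs_hamiltonian_sub_le_of_forall hfbdd fun u v => ?_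
    have i1 := integrable_payoff hfbdd hfcont (γ.map Prod.fst) s u v
    have i2 := integrable_payoff hfbdd hfcont (γ.map Prod.snd) r u v
    rw [integral_map (by fun_prop) i1.1, integral_map (by fun_prop) i2.1,
      ← integral_sub (f := fun q : Ed d × Ed d => f s q.1 u v)
        (g := fun q : Ed d × Ed d => f r q.2 u v)
        (i1.comp_measurable measurable_fst) (i2.comp_measurable measurable_snd)]
    refine (norm_integral_le_of_norm_le
      (f := fun q : Ed d × Ed d => f s q.1 u v - f r q.2 u v) (g := fun q => C * (‖q.1 - q.2‖ + |s - r|))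
      ((hd.add (integrable_const _)).const_mul C) (.of_forall fun q => hflip u v q.1 q.2)).trans ?_
    rw [integral_const_mul, integral_add hd (integrable_const _)]
    simp
  rcases hC.eq_or_lt with rfl | hC
  · simpa using key (m.prod m') inferInstance ⟨by simp, by simp⟩
  · rw [← div_le_iff₀' hC, ← sub_le_iff_le_add]
    refine le_csInf ⟨_, m.prod m', inferInstance, ⟨by simp, by simp⟩, rfl⟩ ?_
    rintro c ⟨γ, hγ, hc, rfl⟩
    rw [sub_le_iff_le_add, div_le_iff₀' hC]
    simpa using key γ hγ hc

variable [CompactSpace A] [CompactSpace B]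

lemma measurable_hamiltonian (hfbdd : ∀ t x u v, |f t x u v| ≤ C)
    (hfcont : Continuous fun q : ℝ × Ed d × A × B => f q.1 q.2.1 q.2.2.1 q.2.2.2)
    {Ω : Type*} [MeasurableSpace Ω] {κ : Ω → Measure (Ed d)} (hκ : Measurable κ)
    (hκp : ∀ ω, IsProbabilityMeasure (κ ω)) (s : ℝ) :
    Measurable fun ω => hamiltonian f s (κ ω) := by
  obtain ⟨D, hDc, hD⟩ := TopologicalSpace.exists_countable_dense A
  obtain ⟨E, hEc, hE⟩ := TopologicalSpace.exists_countable_dense B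
  have := hDc.to_subtype
  have := hEc.to_subtype
  have hH (ω : Ω) : hamiltonian f s (κ ω) = ⨅ u : D, ⨆ v : E, ∫ x, f s x u v ∂(κ ω) := by
    have hc := continuous_integral_payoff hfbdd hfcont (κ ω) s
    have hsup := isCompact_univ.continuous_sSup (K := (univ : Set B))
      (f := fun u v => ∫ x, f s x u v ∂(κ ω)) hc
    simp only [image_univ, sSup_range] at hsup
    rw [hamiltonian, ← hD.ciInf' hsup]
    congr 1 with u
    exact (hE.ciSup' (hc.comp (by fun_prop : Continuous fun v => ((u : A), v)))).symm
  simp only [hH]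
  refine Measurable.iInf fun u => Measurable.iSup fun v => ?_
  let K : ProbabilityTheory.Kernel Ω (Ed d) := ⟨κ, hκ⟩
  have hfx : Continuous fun x => f s x u v :=
    hfcont.comp (by fun_prop : Continuous fun x : Ed d => (s, x, (u : A), (v : B)))
  exact (StronglyMeasurable.integral_kernel (κ := K) hfx.stronglyMeasurable).measurable

end Topology

end Hamiltonian

lemma tendsto_ceil_mul_div (s : ℝ) :
    Tendsto (fun n : ℕ => (⌈((n : ℝ) + 1) * s⌉ : ℝ) / ((n : ℝ) + 1)) atTop (𝓝 s) := by
  refine tendsto_of_tendsto_of_tendsto_of_le_of_le tendsto_const_nhds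
    (by simpa using (tendsto_one_div_add_atTop_nhds_zero_nat (𝕜 := ℝ)).const_add s)
    (fun n => ?_) (fun n => ?_)
  · rw [le_div_iff₀' (by positivity)]
    exact Int.le_ceil _
  · have hn : (0 : ℝ) < n + 1 := by positivity
    rw [div_le_iff₀' hn, mul_add, mul_inv_cancel₀ hn.ne']
    exact (Int.ceil_lt_add_one _).le

lemma measurable_comp_ceil_mul {Ω : Type*} [MeasurableSpace Ω] {h : ℤ → Ω → ℝ}
    (hmeas : ∀ k, Measurable (h k)) (c : ℝ) :
    Measurable fun q : ℝ × Ω => h ⌈c * q.1⌉ q.2 := by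
  have h1 : Measurable fun p : ℤ × Ω => h p.1 p.2 :=
    measurable_from_prod_countable_right fun k => hmeas k
  have h2 : Measurable fun q : ℝ × Ω => (⌈c * q.1⌉, q.2) := by fun_prop
  exact h1.comp h2

lemma stronglyMeasurable_integral_Icc_of_continuousWithinAt {Ω : Type*} [MeasurableSpace Ω]
    {h : ℝ → Ω → ℝ} {t T : ℝ} (hmeas : ∀ s ∈ Icc t T, Measurable (h s))
    (hcont : ∀ ω, ∀ s ∈ Ico t T, ContinuousWithinAt (fun r => h r ω) (Icc s T) s) :
    StronglyMeasurable fun ω => ∫ s in Icc t T, h s ω := by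
  set h' : ℝ → Ω → ℝ := fun s ω => (Icc t T).indicator (fun r => h r ω) s with hh'
  have hmeas' (s : ℝ) : Measurable (h' s) := by
    by_cases hs : s ∈ Icc t T
    · simpa [hh', hs] using hmeas s hs
    · simp [hh', hs]
  have hS : MeasurableSet (Ico t T ×ˢ (univ : Set Ω)) := measurableSet_Ico.prod .univ
  let r (n : ℕ) (k : ℤ) : ℝ := min (k / ((n : ℝ) + 1)) T
  have hgrid (n : ℕ) : Measurable fun q : ℝ × Ω => h' (r n ⌈((n : ℝ) + 1) * q.1⌉) q.2 :=
    measurable_comp_ceil_mul (h := fun k => h' (r n k)) (fun k => hmeas' (r n k)) _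
  have hlim : Measurable ((Ico t T ×ˢ (univ : Set Ω)).indicator fun q => h q.1 q.2) := by
    refine measurable_of_tendsto_metrizable (fun n => (hgrid n).indicator hS)
      (tendsto_pi_nhds.2 fun q => ?_)
    by_cases hq : q ∈ Ico t T ×ˢ (univ : Set Ω)
    · simp only [indicator_of_mem hq]
      have hqt : q.1 ∈ Ico t T := hq.1
      have hmem (n : ℕ) : r n ⌈((n : ℝ) + 1) * q.1⌉ ∈ Icc q.1 T := by
        refine ⟨le_min ?_ hqt.2.le, min_le_right _ _⟩
        rw [le_div_iff₀' (by positivity)]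
        exact Int.le_ceil _
      have hr : Tendsto (fun n => r n ⌈((n : ℝ) + 1) * q.1⌉) atTop (𝓝[Icc q.1 T] q.1) := by
        refine tendsto_nhdsWithin_iff.2 ⟨?_, .of_forall hmem⟩
        simpa [min_eq_left hqt.2.le] using (tendsto_ceil_mul_div q.1).min
          (tendsto_const_nhds (x := T))
      refine ((hcont q.2 q.1 hqt).tendsto.comp hr).congr fun n => ?_
      simp only [hh', Function.comp]
      exact (indicator_of_mem (s := Icc t T) ⟨hqt.1.trans (hmem n).1, (hmem n).2⟩
        fun r => h r q.2).symm
    · simp only [indicator_of_notMem hq, tendsto_const_nhds]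
  have hint (ω : Ω) : ∫ s in Icc t T, h s ω =
      ∫ s, (Ico t T ×ˢ (univ : Set Ω)).indicator (fun q => h q.1 q.2) (s, ω) := by
    rw [integral_Icc_eq_integral_Ico, ← integral_indicator measurableSet_Ico]
    congr 1 with s
    by_cases hs : s ∈ Ico t T
    · rw [indicator_of_mem hs,
        indicator_of_mem (show (s, ω) ∈ Ico t T ×ˢ (univ : Set Ω) from ⟨hs, mem_univ _⟩)]
    · rw [indicator_of_notMem hs,
        indicator_of_notMem (show (s, ω) ∉ Ico t T ×ˢ (univ : Set Ω) from fun hq => hs hq.1)]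
  simp only [hint]
  exact StronglyMeasurable.integral_prod_left' hlim.stronglyMeasurable

section RunningCost

variable {d : ℕ} {A B : Type} {f : ℝ → Ed d → A → B → ℝ} {C T t : ℝ} {m : Measure (Ed d)}

lemma MVP.abs_integral_hamiltonian_le [Nonempty A] [Nonempty B]
    (hfbdd : ∀ t x u v, |f t x u v| ≤ C) (htT : t ≤ T) (X : MVP d T t m) (ω : X.Ω) :
    |∫ s in Icc t T, hamiltonian f s (X.M s ω)| ≤ C * (T - t) := by
  have h := norm_setIntegral_le_of_norm_le_const (μ := volume) (s := Icc t T)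
    (f := fun s => hamiltonian f s (X.M s ω)) (C := C) (by simp) fun s hs => by
      have := (X.inP1 s hs ω).1
      exact abs_hamiltonian_le hfbdd _ _
  simpa [htT] using h

variable [MetricSpace A] [CompactSpace A] [Nonempty A] [MetricSpace B] [CompactSpace B] [Nonempty B]

lemma MVP.stronglyMeasurable_integral_hamiltonian (hfbdd : ∀ t x u v, |f t x u v| ≤ C)
    (hfcont : Continuous fun q : ℝ × Ed d × A × B => f q.1 q.2.1 q.2.2.1 q.2.2.2)
    (hflip : ∀ (u : A) (v : B), ∀ t t' : ℝ, t ∈ Set.Icc 0 T → t' ∈ Set.Icc 0 T →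
      ∀ x x' : Ed d, |f t x u v - f t' x' u v| ≤ C * (‖x - x'‖ + |t - t'|))
    (ht : 0 ≤ t) (X : MVP d T t m) :
    @StronglyMeasurable X.Ω ℝ _ X.mΩ fun ω => ∫ s in Icc t T, hamiltonian f s (X.M s ω) := by
  let _ := X.mΩ
  refine stronglyMeasurable_integral_Icc_of_continuousWithinAt (fun s hs =>
    measurable_hamiltonian hfbdd hfcont (X.meas s) (fun ω => (X.inP1 s hs ω).1) s) fun ω s hs => ?_
  · rw [ContinuousWithinAt, tendsto_iff_norm_sub_tendsto_zero]
    have hW := ((X.cadlag ω).1 s hs).mono_left (nhdsWithin_mono s fun r (hr : r ∈ Icc s T) => hr.1)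
    have hs' : Tendsto (fun r : ℝ => |r - s|) (𝓝[Icc s T] s) (𝓝 0) := by
      have : Continuous fun r : ℝ => |r - s| := by fun_prop
      simpa using (this.tendsto s).mono_left nhdsWithin_le_nhds
    refine squeeze_zero' (.of_forall fun r => norm_nonneg _) ?_
      (by simpa using (hW.add hs').const_mul C)
    filter_upwards [self_mem_nhdsWithin] with r hr
    exact abs_hamiltonian_sub_le hfbdd hfcont
      (fun u v x x' => hflip u v r s ⟨ht.trans (hs.1.trans hr.1), hr.2⟩
        ⟨ht.trans hs.1, hs.2.le⟩ x x')
      (X.inP1 r ⟨hs.1.trans hr.1, hr.2⟩ ω) (X.inP1 s ⟨hs.1, hs.2.le⟩ ω)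

lemma MVP.integrable_integral_hamiltonian (hfbdd : ∀ t x u v, |f t x u v| ≤ C)
    (hfcont : Continuous fun q : ℝ × Ed d × A × B => f q.1 q.2.1 q.2.2.1 q.2.2.2)
    (hflip : ∀ (u : A) (v : B), ∀ t t' : ℝ, t ∈ Set.Icc 0 T → t' ∈ Set.Icc 0 T →
      ∀ x x' : Ed d, |f t x u v - f t' x' u v| ≤ C * (‖x - x'‖ + |t - t'|))
    (ht : t ∈ Icc 0 T) (X : MVP d T t m) :
    
    Integrable[X.mΩ] (fun ω => ∫ s in Icc t T, hamiltonian f s (X.M s ω)) X.P := by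
  let _ := X.mΩ
  have := X.probP
  exact (integrable_const (C * (T - t))).mono'
    (X.stronglyMeasurable_integral_hamiltonian hfbdd hfcont hflip ht.1).aestronglyMeasurable
    (.of_forall (X.abs_integral_hamiltonian_le hfbdd ht.2))

end RunningCost

section Mixture

variable {Ω₁ Ω₂ : Type} [MeasurableSpace Ω₁] [MeasurableSpace Ω₂]

lemma measurableEmbedding_inl : MeasurableEmbedding (Sum.inl : Ω₁ → Ω₁ ⊕ Ω₂) :=
  ⟨Sum.inl_injective, measurable_inl, fun _ hs => measurableSet_inl_image.2 hs⟩

lemma measurableEmbedding_inr : MeasurableEmbedding (Sum.inr : Ω₂ → Ω₁ ⊕ Ω₂) :=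
  ⟨Sum.inr_injective, measurable_inr, fun _ hs => measurableSet_inr_image.2 hs⟩

/-- The law on the disjoint union `Ω₁ ⊕ Ω₂` of a draw from `P₁` with probability `l` and from
`P₂` with probability `1 - l`. -/
def sumMixture (l : ℝ) (P₁ : Measure Ω₁) (P₂ : Measure Ω₂) : Measure (Ω₁ ⊕ Ω₂) :=
  ENNReal.ofReal l • P₁.map Sum.inl + ENNReal.ofReal (1 - l) • P₂.map Sum.inr

variable {l : ℝ} {P₁ : Measure Ω₁} {P₂ : Measure Ω₂}

lemma isProbabilityMeasure_sumMixture [IsProbabilityMeasure P₁] [IsProbabilityMeasure P₂]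
    (hl0 : 0 < l) (hl1 : l < 1) : IsProbabilityMeasure (sumMixture l P₁ P₂) := by
  constructor
  simp only [sumMixture, Measure.add_apply, Measure.smul_apply, smul_eq_mul,
    Measure.map_apply measurable_inl .univ, Measure.map_apply measurable_inr .univ, preimage_univ,
    measure_univ, mul_one]
  rw [← ENNReal.ofReal_add hl0.le (by linarith)]
  simp

lemma integrable_sumMixture {F : Ω₁ ⊕ Ω₂ → ℝ} (h₁ : Integrable (F ∘ Sum.inl) P₁)
    (h₂ : Integrable (F ∘ Sum.inr) P₂) : Integrable F (sumMixture l P₁ P₂) :=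
  ((measurableEmbedding_inl.integrable_map_iff.2 h₁).smul_measure ENNReal.ofReal_ne_top).add_measure
    ((measurableEmbedding_inr.integrable_map_iff.2 h₂).smul_measure ENNReal.ofReal_ne_top)

lemma setIntegral_sumMixture (hl0 : 0 < l) (hl1 : l < 1) {F : Ω₁ ⊕ Ω₂ → ℝ}
    (h₁ : Integrable (F ∘ Sum.inl) P₁) (h₂ : Integrable (F ∘ Sum.inr) P₂) (S : Set (Ω₁ ⊕ Ω₂)) :
    ∫ ω in S, F ω ∂(sumMixture l P₁ P₂) = l * ∫ ω in Sum.inl ⁻¹' S, F (Sum.inl ω) ∂P₁ +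
      (1 - l) * ∫ ω in Sum.inr ⁻¹' S, F (Sum.inr ω) ∂P₂ := by
  rw [sumMixture, Measure.restrict_add, Measure.restrict_smul, Measure.restrict_smul,
    integral_add_measure, integral_smul_measure, integral_smul_measure,
    measurableEmbedding_inl.setIntegral_map, measurableEmbedding_inr.setIntegral_map,
    ENNReal.toReal_ofReal hl0.le, ENNReal.toReal_ofReal (by linarith), smul_eq_mul, smul_eq_mul]
  · exact ((measurableEmbedding_inl.integrable_map_iff.2 h₁).integrableOn).smul_measure
      ENNReal.ofReal_ne_top
  · exact ((measurableEmbedding_inr.integrable_map_iff.2 h₂).integrableOn).smul_measure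
      ENNReal.ofReal_ne_top

lemma integral_sumMixture (hl0 : 0 < l) (hl1 : l < 1) {F : Ω₁ ⊕ Ω₂ → ℝ}
    (h₁ : Integrable (F ∘ Sum.inl) P₁) (h₂ : Integrable (F ∘ Sum.inr) P₂) :
    ∫ ω, F ω ∂(sumMixture l P₁ P₂) =
      l * ∫ ω, F (Sum.inl ω) ∂P₁ + (1 - l) * ∫ ω, F (Sum.inr ω) ∂P₂ := by
  simpa using setIntegral_sumMixture hl0 hl1 h₁ h₂ univ

end Mixture

lemma genFiltration_le {Ω : Type} [mΩ : MeasurableSpace Ω] {d : ℕ} {M : ℝ → Ω → Measure (Ed d)}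
    (hM : ∀ s, Measurable (M s)) (t s : ℝ) : genFiltration d M t s ≤ mΩ :=
  iInf₂_le_of_le (s + 1) (by simp) (iSup₂_le fun r _ => (hM r).comap_le)

lemma measurable_genFiltration {Ω : Type} {d : ℕ} (M : ℝ → Ω → Measure (Ed d)) {t s : ℝ}
    (hts : t ≤ s) : Measurable[genFiltration d M t s] (M s) := by
  rw [measurable_iff_comap_le]
  exact le_iInf₂ fun u hu => le_iSup₂_of_le s ⟨hts, le_of_lt hu⟩ le_rfl

lemma measurable_genFiltration_comp {Ω Ω' : Type} {d : ℕ} (M : ℝ → Ω → Measure (Ed d))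
    (g : Ω' → Ω) (t s : ℝ) :
    Measurable[genFiltration d (fun r ω => M r (g ω)) t s, genFiltration d M t s] g := by
  rw [measurable_iff_comap_le]
  refine le_iInf₂ fun u hu => ?_
  refine (MeasurableSpace.comap_mono (iInf₂_le u hu)).trans ?_
  simp only [MeasurableSpace.comap_iSup, MeasurableSpace.comap_comp]
  rfl

section Expectations

variable {d : ℕ} {Ω : Type*} [MeasurableSpace Ω] {κ : Ω → Measure (Ed d)}

lemma measurable_integral_boundedContinuous (hκ : Measurable κ) (φ : Ed d →ᵇ ℝ) :
    Measurable fun ω => ∫ x, φ x ∂(κ ω) := by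
  let K : ProbabilityTheory.Kernel Ω (Ed d) := ⟨κ, hκ⟩
  exact (StronglyMeasurable.integral_kernel (κ := K) φ.continuous.stronglyMeasurable).measurable

lemma measurable_heatFlow (hκ : Measurable κ) (hp : ∀ ω, IsProbabilityMeasure (κ ω)) (r s : ℝ) :
    Measurable fun ω => heatFlow d r s (κ ω) := by
  let K : ProbabilityTheory.Kernel Ω (Ed d) := ⟨κ, hκ⟩
  have : ProbabilityTheory.IsMarkovKernel K := ⟨hp⟩
  have h := ((K.prod (ProbabilityTheory.Kernel.const Ω (scaledGaussian d √(s - r)))).map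
    (fun q => q.1 + q.2)).measurable
  convert h using 2 with ω
  rw [heatFlow_eq_conv, ProbabilityTheory.Kernel.map_apply _ (by fun_prop),
    ProbabilityTheory.Kernel.prod_apply]
  rfl

lemma abs_integral_boundedContinuous_le (m : Measure (Ed d)) [IsProbabilityMeasure m]
    (φ : Ed d →ᵇ ℝ) : |∫ x, φ x ∂m| ≤ ‖φ‖ := by
  simpa using norm_integral_le_of_norm_le_const (μ := m) (.of_forall φ.norm_coe_le_norm)

lemma integrable_integral_boundedContinuous {P : Measure Ω} [IsFiniteMeasure P] (hκ : Measurable κ)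
    (hp : ∀ ω, IsProbabilityMeasure (κ ω)) (φ : Ed d →ᵇ ℝ) :
    Integrable (fun ω => ∫ x, φ x ∂(κ ω)) P :=
  (integrable_const ‖φ‖).mono' (measurable_integral_boundedContinuous hκ φ).aestronglyMeasurable
    (.of_forall fun _ => abs_integral_boundedContinuous_le _ φ)

end Expectations

section MixtureProcess

variable {d : ℕ} {T t : ℝ} {m m₁ m₂ : Measure (Ed d)}

lemma MVP.setIntegral_eq_heatFlow (X : MVP d T t m) {t₁ t₂ : ℝ} (h1 : t ≤ t₁) (h12 : t₁ ≤ t₂)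
    (h2 : t₂ ≤ T) (φ : Ed d →ᵇ ℝ) {S : Set X.Ω}
    (hS : MeasurableSet[genFiltration d X.M t t₁] S) :
    @integral X.Ω ℝ _ _ X.mΩ (@Measure.restrict _ X.mΩ X.P S)
        (fun ω => ∫ x, φ x ∂(heatFlow d t₁ t₂ (X.M t₁ ω))) =
      @integral X.Ω ℝ _ _ X.mΩ (@Measure.restrict _ X.mΩ X.P S)
        (fun ω => ∫ x, φ x ∂(X.M t₂ ω)) := by
  let _ := X.mΩ
  have := X.probP
  have hm := genFiltration_le X.meas t t₁
  rw [← setIntegral_condExp hm (integrable_integral_boundedContinuous (X.meas t₂)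
    (fun ω => (X.inP1 t₂ ⟨h1.trans h12, h2⟩ ω).1) φ) hS]
  exact setIntegral_congr_ae (hm _ hS) ((X.cond t₁ t₂ h1 h12 h2 φ).mono fun ω h _ => h.symm)

/-- The mixture of two measure-valued processes: run `X` with probability `l` and `Y` with
probability `1 - l`. -/
def MVP.mix (htT : t ≤ T) (X : MVP d T t m₁) (Y : MVP d T t m₂) [IsProbabilityMeasure m₁]
    [IsProbabilityMeasure m₂] {l : ℝ} (hl0 : 0 < l) (hl1 : l < 1) :
    MVP d T t (ENNReal.ofReal l • m₁ + ENNReal.ofReal (1 - l) • m₂) where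
  Ω := X.Ω ⊕ Y.Ω
  mΩ :=
    letI := X.mΩ
    letI := Y.mΩ
    inferInstance
  P := @sumMixture _ _ X.mΩ Y.mΩ l X.P Y.P
  probP := by
    let _ := X.mΩ
    let _ := Y.mΩ
    have := X.probP
    have := Y.probP
    exact isProbabilityMeasure_sumMixture hl0 hl1
  M s := Sum.elim (X.M s) (Y.M s)
  meas s := by
    let _ := X.mΩ
    let _ := Y.mΩ
    exact (X.meas s).sumElim (Y.meas s)
  inP1 s hs := by
    rintro (ω | ω)
    exacts [X.inP1 s hs ω, Y.inP1 s hs ω]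
  cadlag := by
    rintro (ω | ω)
    exacts [X.cadlag ω, Y.cadlag ω]
  init φ := by
    let _ := X.mΩ
    let _ := Y.mΩ
    have := X.probP
    have := Y.probP
    rw [integral_sumMixture hl0 hl1 (F := fun ω => ∫ x, φ x ∂(Sum.elim (X.M t) (Y.M t) ω))
      (integrable_integral_boundedContinuous (X.meas t) (fun ω => (X.inP1 t ⟨le_rfl, htT⟩ ω).1) φ)
      (integrable_integral_boundedContinuous (Y.meas t) (fun ω => (Y.inP1 t ⟨le_rfl, htT⟩ ω).1) φ),
      integral_add_measure ((φ.integrable _).smul_measure ENNReal.ofReal_ne_top)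
        ((φ.integrable _).smul_measure ENNReal.ofReal_ne_top),
      integral_smul_measure, integral_smul_measure, ENNReal.toReal_ofReal hl0.le,
      ENNReal.toReal_ofReal (by linarith)]
    simp only [Sum.elim_inl, Sum.elim_inr, smul_eq_mul, X.init, Y.init]
  cond t₁ t₂ h1 h12 h2 φ := by
    let _ := X.mΩ
    let _ := Y.mΩ
    have := X.probP
    have := Y.probP
    have := isProbabilityMeasure_sumMixture (P₁ := X.P) (P₂ := Y.P) hl0 hl1
    have ht₁ : t₁ ∈ Icc t T := ⟨h1, h12.trans h2⟩
    have ht₂ : t₂ ∈ Icc t T := ⟨h1.trans h12, h2⟩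
    set N : ℝ → X.Ω ⊕ Y.Ω → Measure (Ed d) := fun s => Sum.elim (X.M s) (Y.M s) with hN
    have hNp (s : ℝ) (hs : s ∈ Icc t T) (ω : X.Ω ⊕ Y.Ω) : IsProbabilityMeasure (N s ω) := by
      rcases ω with ω | ω
      exacts [(X.inP1 s hs ω).1, (Y.inP1 s hs ω).1]
    have hNm (s : ℝ) : Measurable (N s) := (X.meas s).sumElim (Y.meas s)
    have hXf := integrable_integral_boundedContinuous (P := X.P) (X.meas t₂)
      (fun ω => (X.inP1 t₂ ht₂ ω).1) φ
    have hYf := integrable_integral_boundedContinuous (P := Y.P) (Y.meas t₂)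
      (fun ω => (Y.inP1 t₂ ht₂ ω).1) φ
    have hXg := integrable_integral_boundedContinuous (P := X.P)
      (measurable_heatFlow (X.meas t₁) (fun ω => (X.inP1 t₁ ht₁ ω).1) t₁ t₂)
      (fun ω => ((X.inP1 t₁ ht₁ ω).heatFlow t₁ t₂).1) φ
    have hYg := integrable_integral_boundedContinuous (P := Y.P)
      (measurable_heatFlow (Y.meas t₁) (fun ω => (Y.inP1 t₁ ht₁ ω).1) t₁ t₂)
      (fun ω => ((Y.inP1 t₁ ht₁ ω).heatFlow t₁ t₂).1) φ
    have hf : Integrable (fun ω => ∫ x, φ x ∂(N t₂ ω)) (sumMixture l X.P Y.P) :=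
      integrable_sumMixture hXf hYf
    have hg : Integrable (fun ω => ∫ x, φ x ∂(heatFlow d t₁ t₂ (N t₁ ω)))
        (sumMixture l X.P Y.P) := integrable_sumMixture hXg hYg
    refine (ae_eq_condExp_of_forall_setIntegral_eq (genFiltration_le hNm t t₁) hf
      (fun S _ _ => hg.integrableOn) (fun S hS _ => ?_) ?_).symm
    · rw [setIntegral_sumMixture hl0 hl1 (F := fun ω => ∫ x, φ x ∂(heatFlow d t₁ t₂ (N t₁ ω)))
        hXg hYg, setIntegral_sumMixture hl0 hl1 (F := fun ω => ∫ x, φ x ∂(N t₂ ω)) hXf hYf]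
      congr 2
      · exact X.setIntegral_eq_heatFlow h1 h12 h2 φ
          (measurable_genFiltration_comp N Sum.inl t t₁ hS)
      · exact Y.setIntegral_eq_heatFlow h1 h12 h2 φ
          (measurable_genFiltration_comp N Sum.inr t t₁ hS)
    · refine Measurable.stronglyMeasurable ?_ |>.aestronglyMeasurable
      let _ := genFiltration d N t t₁
      exact measurable_integral_boundedContinuous
        (measurable_heatFlow (measurable_genFiltration N h1) (hNp t₁ ht₁) t₁ t₂) φ

variable {A B : Type} {f : ℝ → Ed d → A → B → ℝ} {C : ℝ}

lemma bddBelow_mvCost [Nonempty A] [Nonempty B] (hfbdd : ∀ t x u v, |f t x u v| ≤ C)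
    (htT : t ≤ T) : BddBelow {r : ℝ | ∃ X : MVP d T t m, r = mvCost f X} := by
  refine ⟨-(C * (T - t)), ?_⟩
  rintro _ ⟨X, rfl⟩
  let _ := X.mΩ
  have := X.probP
  have h := norm_integral_le_of_norm_le_const (μ := X.P)
    (f := fun ω => ∫ s in Icc t T, hamiltonian f s (X.M s ω))
    (.of_forall (X.abs_integral_hamiltonian_le hfbdd htT))
  simp only [Real.norm_eq_abs, probReal_univ, mul_one] at h
  exact (abs_le.1 h).1

variable [MetricSpace A] [CompactSpace A] [Nonempty A] [MetricSpace B] [CompactSpace B] [Nonempty B]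

lemma mvCost_mix (hfbdd : ∀ t x u v, |f t x u v| ≤ C)
    (hfcont : Continuous fun q : ℝ × Ed d × A × B => f q.1 q.2.1 q.2.2.1 q.2.2.2)
    (hflip : ∀ (u : A) (v : B), ∀ t t' : ℝ, t ∈ Set.Icc 0 T → t' ∈ Set.Icc 0 T →
      ∀ x x' : Ed d, |f t x u v - f t' x' u v| ≤ C * (‖x - x'‖ + |t - t'|))
    (ht : t ∈ Icc 0 T) (X : MVP d T t m₁) (Y : MVP d T t m₂) [IsProbabilityMeasure m₁]
    [IsProbabilityMeasure m₂] {l : ℝ} (hl0 : 0 < l) (hl1 : l < 1) :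
    mvCost f (X.mix ht.2 Y hl0 hl1) = l * mvCost f X + (1 - l) * mvCost f Y :=
  @integral_sumMixture _ _ X.mΩ Y.mΩ _ _ _ hl0 hl1
    (fun ω => ∫ s in Icc t T, hamiltonian f s (Sum.elim (X.M s) (Y.M s) ω))
    (X.integrable_integral_hamiltonian hfbdd hfcont hflip ht)
    (Y.integrable_integral_hamiltonian hfbdd hfcont hflip ht)

end MixtureProcess

/-- For every fixed `t ∈ [0,T]`, the value function `m ↦ V(t,m)` is
convex on `𝒫₂`: for all `m₁, m₂ ∈ 𝒫₂` and `λ ∈ (0,1)`,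
`V(t, λm₁ + (1−λ)m₂) ≤ λ V(t,m₁) + (1−λ) V(t,m₂)`. -/
theorem gameValue_convex (d : ℕ) (T : ℝ) (hT : 0 ≤ T)
    {A B : Type} [MetricSpace A] [CompactSpace A] [Nonempty A]
    [MetricSpace B] [CompactSpace B] [Nonempty B]
    (f : ℝ → Ed d → A → B → ℝ) (C : ℝ)
    (hfbdd : ∀ t x u v, |f t x u v| ≤ C)
    (hfcont : Continuous fun q : ℝ × Ed d × A × B => f q.1 q.2.1 q.2.2.1 q.2.2.2)
    (hflip : ∀ (u : A) (v : B), ∀ t t' : ℝ, t ∈ Set.Icc 0 T → t' ∈ Set.Icc 0 T →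
      ∀ x x' : Ed d, |f t x u v - f t' x' u v| ≤ C * (‖x - x'‖ + |t - t'|))
    (hIsaacs : ∀ t ∈ Set.Icc 0 T, ∀ m : Measure (Ed d), MemP d 2 m →
      (⨅ u : A, ⨆ v : B, ∫ x, f t x u v ∂m) = ⨆ v : B, ⨅ u : A, ∫ x, f t x u v ∂m)
    (t : ℝ) (ht : t ∈ Set.Icc 0 T)
    (m₁ m₂ : Measure (Ed d)) (hm₁ : MemP d 2 m₁) (hm₂ : MemP d 2 m₂)
    (l : ℝ) (hl0 : 0 < l) (hl1 : l < 1) :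
    gameValue d f T t (ENNReal.ofReal l • m₁ + ENNReal.ofReal (1 - l) • m₂)
      ≤ l * gameValue d f T t m₁ + (1 - l) * gameValue d f T t m₂ := by
  have := hm₁.1
  have := hm₂.1
  have hne {m : Measure (Ed d)} (hm : MemP d 2 m) :
      {r : ℝ | ∃ X : MVP d T t m, r = mvCost f X}.Nonempty :=
    ⟨_, heatFlowMVP T t hm.one_of_two, rfl⟩
  refine le_of_forall_pos_le_add fun ε hε => ?_
  obtain ⟨_, ⟨X, rfl⟩, hX⟩ := Real.lt_sInf_add_pos (hne hm₁) hε
  obtain ⟨_, ⟨Y, rfl⟩, hY⟩ := Real.lt_sInf_add_pos (hne hm₂) hε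
  calc gameValue d f T t (ENNReal.ofReal l • m₁ + ENNReal.ofReal (1 - l) • m₂)
      ≤ mvCost f (X.mix ht.2 Y hl0 hl1) := csInf_le (bddBelow_mvCost hfbdd ht.2) ⟨_, rfl⟩
    _ = l * mvCost f X + (1 - l) * mvCost f Y := mvCost_mix hfbdd hfcont hflip ht X Y hl0 hl1
    _ ≤ l * (gameValue d f T t m₁ + ε) + (1 - l) * (gameValue d f T t m₂ + ε) := by
      exact add_le_add (mul_le_mul_of_nonneg_left hX.le hl0.le)
        (mul_le_mul_of_nonneg_left hY.le (sub_nonneg.2 hl1.le))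
    _ = l * gameValue d f T t m₁ + (1 - l) * gameValue d f T t m₂ + ε := by ring

end
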